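/- The degree of the minimal polynomial of h over E is even; that is, Even ((minpoly E h).natDegree). -/

import Mathlib

noncomputable section

abbrev R2 : Type := MvPolynomial (Fin 2) ℝ

def x : R2 := MvPolynomial.X 0
def y : R2 := MvPolynomial.X 1
def t : R2 := x * y - 1
def h : R2 := t * (x * t + 1)
def f : R2 := (x * t + 1) ^ 2 * (t ^ 2 + y)
def P : R2 := f + h
def q : R2 := -t ^ 2 - 6 * t * h * (h + 1)
def u : R2 :=
  170 * f * h + 91 * h ^ 2 + 195 * f * h ^ 2 + 69 * h ^ 3 + 75 * f * h ^ 3 + MvPolynomial.C (75 / 4 : ℝ) * h ^ 4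
def Q : R2 := q - u

abbrev K : Type := FractionRing (MvPolynomial (Fin 2) ℝ)

/-- The canonical image of a polynomial in the rational function field `K = ℝ(x,y)`. -/
def ι : R2 →+* K := algebraMap R2 K

/-- The images of `P`, `Q`, `h` in the rational function field `K`. -/
def PK : K := ι P
def QK : K := ι Q
def hK : K := ι h

/-- `E = ℝ(P,Q)`, the intermediate field of `K` over `ℝ` generated by `P` and `Q`. -/
def E : IntermediateField ℝ K := IntermediateField.adjoin ℝ ({PK, QK} : Set K)

section RationalFunctions

open Polynomial IntermediateField algebraAdjoinAdjoin

variable {k F : Type*} [Field k] [Field F] [Algebra k F]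

theorem RatFunc.max_natDegree_num_denom_div {a b : k[X]} (hb : b ≠ 0) (hab : IsCoprime a b) :
    max (RatFunc.num (algebraMap k[X] (RatFunc k) a / algebraMap k[X] (RatFunc k) b)).natDegree
      (RatFunc.denom (algebraMap k[X] (RatFunc k) a / algebraMap k[X] (RatFunc k) b)).natDegree =
    max a.natDegree b.natDegree := by
  set g := algebraMap k[X] (RatFunc k) a / algebraMap k[X] (RatFunc k) b with hg
  have hmul : g.num * b = a * g.denom := by
    apply RatFunc.algebraMap_injective k
    have h1 := RatFunc.num_div_denom g
    have hb' : algebraMap k[X] (RatFunc k) b ≠ 0 := RatFunc.algebraMap_ne_zero hb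
    have hd' : algebraMap k[X] (RatFunc k) g.denom ≠ 0 :=
      RatFunc.algebraMap_ne_zero g.denom_ne_zero
    rw [map_mul, map_mul, ← div_eq_div_iff hd' hb', h1]
  have hnum : Associated g.num a := associated_of_dvd_dvd (RatFunc.num_div_dvd a hb)
    (hab.dvd_of_dvd_mul_right ⟨g.denom, hmul⟩)
  have hdenom : Associated g.denom b := associated_of_dvd_dvd (RatFunc.denom_div_dvd a b)
    (hab.symm.dvd_of_dvd_mul_left ⟨g.num, by rw [← hmul, mul_comm]⟩)
  rw [natDegree_eq_of_degree_eq (degree_eq_degree_of_associated hnum),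
    natDegree_eq_of_degree_eq (degree_eq_degree_of_associated hdenom)]

/-- If `θ` is transcendental over `k` and `a`, `b` are coprime polynomials, then `θ` has degree
`max (deg a) (deg b)` over `k(a(θ)/b(θ))`. -/
theorem natDegree_minpoly_adjoin_div {θ : F} (hθ : Transcendental k θ) {a b : k[X]} (hb : b ≠ 0)
    (hab : IsCoprime a b) (hdeg : 0 < max a.natDegree b.natDegree) :
    (minpoly k⟮aeval θ a / aeval θ b⟯ θ).natDegree = max a.natDegree b.natDegree := by
  let g : RatFunc k := algebraMap k[X] (RatFunc k) a / algebraMap k[X] (RatFunc k) b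
  let ψ : RatFunc k →ₐ[k] F :=
    k⟮θ⟯.val.comp (RatFunc.algEquivOfTranscendental θ hθ).toAlgHom
  have hψ (c : k[X]) : ψ (algebraMap k[X] (RatFunc k) c) = aeval θ c := by
    simp [ψ]
  have hψg : ψ g = aeval θ a / aeval θ b := by
    rw [map_div₀, hψ, hψ]
  have hmax := RatFunc.max_natDegree_num_denom_div hb hab
  have hgC : ¬ ∃ c, g = RatFunc.C c := by
    rintro ⟨c, hc⟩
    change max g.num.natDegree g.denom.natDegree = _ at hmax
    rw [← hmax, hc] at hdeg
    simp at hdeg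
  have hmap : k⟮g⟯.map ψ = k⟮aeval θ a / aeval θ b⟯ := by
    rw [adjoin_map, Set.image_singleton, hψg]
  let e : k⟮g⟯ ≃ₐ[k] k⟮aeval θ a / aeval θ b⟯ :=
    (k⟮g⟯.equivMap ψ).trans (equivOfEq hmap)
  have he (z : k⟮g⟯) : (e z : F) = ψ z := rfl
  let p := (g.minpolyX k⟮g⟯).mapEquiv e.toRingEquiv
  have hirr : Irreducible p := by
    rw [MulEquiv.irreducible_iff]
    exact g.irreducible_minpolyX hgC
  have hroot : aeval θ p = 0 := by
    have h1 := congrArg ψ g.minpolyX_aeval_X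
    rw [map_zero, aeval_def, ← AlgHom.coe_toRingHom, hom_eval₂] at h1
    rw [aeval_def]
    change eval₂ _ _ (Polynomial.map _ _) = 0
    rw [eval₂_map]
    have hX : ψ RatFunc.X = θ := by simpa using hψ Polynomial.X
    have hcomp : (algebraMap k⟮aeval θ a / aeval θ b⟯ F).comp
        (e.toRingEquiv : k⟮g⟯ →+* k⟮aeval θ a / aeval θ b⟯) =
        (ψ : RatFunc k →+* F).comp (algebraMap k⟮g⟯ (RatFunc k)) := RingHom.ext he
    rw [AlgHom.coe_toRingHom, hX, ← hcomp] at h1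
    exact h1
  rw [← minpoly.eq_of_irreducible hirr hroot, natDegree_mul_C (by simpa using hirr.ne_zero)]
  change (Polynomial.map _ _).natDegree = _
  rw [natDegree_map, g.natDegree_minpolyX, hmax]

end RationalFunctions

section Pinchuk

open Polynomial IntermediateField algebraAdjoinAdjoin

theorem ι_injective : Function.Injective ι := IsFractionRing.injective R2 K

theorem f_mul_sub : f * (h - t) = h ^ 2 * (h + 1) := by
  simp only [f, h, t]; ring

theorem x_mul_sq : x * t ^ 2 = h - t := by
  simp only [h]; ring

/-- A polynomial is nonzero as soon as it does not vanish at some point. -/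
theorem ne_zero_of_eval_ne_zero {g : R2} (v : Fin 2 → ℝ) (hg : MvPolynomial.eval v g ≠ 0) :
    g ≠ 0 := by
  rintro rfl
  simp at hg

theorem x_ne_zero : x ≠ 0 := MvPolynomial.X_ne_zero 0

theorem t_ne_zero : t ≠ 0 :=
  ne_zero_of_eval_ne_zero 0 (by simp [t, x, y])

theorem f_ne_zero : f ≠ 0 :=
  ne_zero_of_eval_ne_zero 0 (by simp [f, t, x, y])

theorem P_ne_zero : P ≠ 0 :=
  ne_zero_of_eval_ne_zero ![2, 0] (by simp [P, f, h, t, x, y]; norm_num)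

theorem P_add_one_ne_zero : P + 1 ≠ 0 :=
  ne_zero_of_eval_ne_zero 0 (by simp [P, f, h, t, x, y])

theorem ι_x_mem_and_ι_y_mem {S : Subfield K} (hP : PK ∈ S) (hh : hK ∈ S) : ι x ∈ S ∧ ι y ∈ S := by
  have hf0 : ι f ≠ 0 := (map_ne_zero_iff ι ι_injective).2 f_ne_zero
  have ht0 : ι t ≠ 0 := (map_ne_zero_iff ι ι_injective).2 t_ne_zero
  have hx0 : ι x ≠ 0 := (map_ne_zero_iff ι ι_injective).2 x_ne_zero
  have hf : ι f ∈ S := by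
    have : ι f = PK - hK := by simp [PK, hK, P]
    exact this ▸ S.sub_mem hP hh
  have ht : ι t ∈ S := by
    have h1 := congrArg ι f_mul_sub
    simp only [map_mul, map_sub, map_pow, map_add, map_one] at h1
    have : ι t = hK - hK ^ 2 * (hK + 1) / ι f := by
      simp only [hK]
      field_simp
      linear_combination -h1
    rw [this]
    exact S.sub_mem hh (S.div_mem (S.mul_mem (S.pow_mem hh 2) (S.add_mem hh S.one_mem)) hf)
  have hx : ι x ∈ S := by
    have h1 := congrArg ι x_mul_sq
    simp only [map_mul, map_sub, map_pow] at h1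
    rw [eq_div_of_mul_eq (pow_ne_zero 2 ht0) h1]
    exact S.div_mem (S.sub_mem hh ht) (S.pow_mem ht 2)
  refine ⟨hx, ?_⟩
  have : ι y = (ι t + 1) / ι x := by
    rw [eq_div_iff hx0]
    simp [t, mul_comm]
  rw [this]
  exact S.div_mem (S.add_mem ht S.one_mem) hx

theorem adjoin_x_y : IntermediateField.adjoin ℝ {ι x, ι y} = ⊤ := by
  rw [eq_top_iff]
  rintro z -
  have hpoly (p : R2) : ι p ∈ IntermediateField.adjoin ℝ {ι x, ι y} := by
    induction p using MvPolynomial.induction_on with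
    | C a =>
      exact (IntermediateField.adjoin ℝ {ι x, ι y}).algebraMap_mem a
    | add p q hp hq => rw [map_add]; exact add_mem hp hq
    | mul_X p i hp =>
      rw [map_mul]
      refine mul_mem hp (IntermediateField.subset_adjoin _ _ ?_)
      fin_cases i
      · exact Or.inl rfl
      · exact Or.inr rfl
  obtain ⟨a, b, -, rfl⟩ := IsFractionRing.div_surjective (A := R2) z
  exact div_mem (hpoly a) (hpoly b)

theorem adjoin_P_adjoin_h : ℝ⟮PK⟯⟮hK⟯ = ⊤ := by
  rw [← restrictScalars_eq_top_iff (K := ℝ), adjoin_simple_adjoin_simple, eq_top_iff,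
    ← adjoin_x_y, IntermediateField.adjoin_le_iff]
  have hmem := ι_x_mem_and_ι_y_mem (S := (ℝ⟮PK, hK⟯).toSubfield)
    (IntermediateField.subset_adjoin _ _ (by simp)) (IntermediateField.subset_adjoin _ _ (by simp))
  rintro z (rfl | rfl)
  exacts [hmem.1, hmem.2]

theorem two_le_trdeg : 2 ≤ Algebra.trdeg ℝ K := by
  have h1 := trdeg_le_of_injective (R := ℝ) (IsScalarTower.toAlgHom ℝ R2 K) ι_injective
  rw [MvPolynomial.trdeg_of_isDomain] at h1
  simpa using h1

theorem transcendental_h : Transcendental ℝ⟮PK⟯ hK := by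
  intro halg
  have : Algebra.IsAlgebraic ℝ⟮PK⟯ ℝ⟮PK⟯⟮hK⟯ := isAlgebraic_adjoin_simple halg.isIntegral
  have : Algebra.IsAlgebraic ℝ⟮PK⟯ K :=
    ((equivOfEq adjoin_P_adjoin_h).trans topEquiv).isAlgebraic
  have : Algebra.IsAlgebraic (Algebra.adjoin ℝ {PK}) K :=
    Algebra.IsAlgebraic.trans (Algebra.adjoin ℝ {PK}) ℝ⟮PK⟯ K
  have hle := two_le_trdeg.trans (Algebra.IsAlgebraic.trdeg_le_cardinalMk ℝ ({PK} : Set K))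
  simp at hle

/-- Numerator of `Q` as a rational function of `h` over `k`, where `p` stands for `P`. -/
def qNum {k : Type*} [Field k] (p : k) : k[X] :=
  -(X * (C p - X) - X ^ 2 * (X + 1)) ^ 2
    - 6 * (X * (C p - X) - X ^ 2 * (X + 1)) * X * (X + 1) * (C p - X)
    - (170 * (C p - X) * X + 91 * X ^ 2 + 195 * (C p - X) * X ^ 2 + 69 * X ^ 3
      + 75 * (C p - X) * X ^ 3 + C (75 / 4) * X ^ 4) * (X - C p) ^ 2

theorem natDegree_qNum {k : Type*} [Field k] [CharZero k] (p : k) : (qNum p).natDegree = 6 := by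
  unfold qNum
  have hcoeff : ((X * (C p - X) - X ^ 2 * (X + 1)) ^ 2).coeff 6 = 1 := by
    have h3 : ((X * (C p - X) - X ^ 2 * (X + 1)) : k[X]).coeff 3 = -1 := by
      compute_degree!
    have hle : ((X * (C p - X) - X ^ 2 * (X + 1)) : k[X]).natDegree ≤ 3 := by
      compute_degree
    simpa [h3] using coeff_pow_of_natDegree_le (m := 2) hle
  compute_degree
  all_goals norm_num [hcoeff]

theorem isCoprime_qNum {k : Type*} [Field k] {p : k} (hp : p ≠ 0) (hp1 : p + 1 ≠ 0) :
    IsCoprime (qNum p) ((X - C p) ^ 2) := by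
  refine (IsCoprime.symm ?_).pow_right
  rw [(irreducible_X_sub_C p).coprime_iff_not_dvd, dvd_iff_isRoot, IsRoot.def]
  simp [qNum, hp, hp1]

theorem aeval_qNum_div : aeval hK (qNum (AdjoinSimple.gen ℝ PK)) /
    aeval hK ((X - C (AdjoinSimple.gen ℝ PK)) ^ 2) = QK := by
  have hf0 : ι f ≠ 0 := (map_ne_zero_iff ι ι_injective).2 f_ne_zero
  have ht := congrArg ι f_mul_sub
  simp only [map_mul, map_sub, map_pow, map_add, map_one] at ht
  have hC : ι (MvPolynomial.C (75 / 4 : ℝ)) = 75 / 4 := by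
    change algebraMap R2 K (algebraMap ℝ R2 (75 / 4)) = _
    rw [← IsScalarTower.algebraMap_apply, map_div₀, map_ofNat, map_ofNat]
  have hP : PK = ι f + ι h := by simp [PK, P]
  have hT : ι h * ι f - ι h ^ 2 * (ι h + 1) = ι t * ι f := by linear_combination ht
  rw [div_eq_iff (by simpa [hP, hK] using hf0)]
  simp only [qNum, map_sub, map_neg, map_mul, map_pow, map_add, map_one, aeval_X, aeval_C,
    map_ofNat, map_div₀, AdjoinSimple.algebraMap_gen, hP, hK, add_sub_cancel_right, hT, QK, Q, q, u, hC]
  ring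

theorem E_eq : E = (ℝ⟮PK⟯⟮QK⟯).restrictScalars ℝ :=
  (adjoin_simple_adjoin_simple ℝ PK QK).symm

theorem natDegree_minpoly_h : (minpoly ℝ⟮PK⟯⟮QK⟯ hK).natDegree = 6 := by
  have hp : AdjoinSimple.gen ℝ PK ≠ 0 := fun h0 ↦ by
    have := congrArg (algebraMap ℝ⟮PK⟯ K) h0
    rw [AdjoinSimple.algebraMap_gen, map_zero] at this
    exact (map_ne_zero_iff ι ι_injective).2 P_ne_zero this
  have hp1 : AdjoinSimple.gen ℝ PK + 1 ≠ 0 := fun h0 ↦ by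
    have := congrArg (algebraMap ℝ⟮PK⟯ K) h0
    rw [map_add, AdjoinSimple.algebraMap_gen, map_zero, map_one] at this
    exact (map_ne_zero_iff ι ι_injective).2 P_add_one_ne_zero (by simpa [PK] using this)
  have hdeg : max (qNum (AdjoinSimple.gen ℝ PK)).natDegree
      ((X - C (AdjoinSimple.gen ℝ PK)) ^ 2).natDegree = 6 := by
    rw [natDegree_qNum, natDegree_pow, natDegree_X_sub_C]
    rfl
  rw [← aeval_qNum_div, natDegree_minpoly_adjoin_div transcendental_h
    (pow_ne_zero 2 (X_sub_C_ne_zero _)) (isCoprime_qNum hp hp1) (by omega), hdeg]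

end Pinchuk

/-- The degree of the minimal polynomial of `h` over `E = ℝ(P,Q)` is even. -/
theorem pinchuk_minpoly_degree_even :
    Even ((minpoly E hK).natDegree) := by
  rw [E_eq]
  change Even (minpoly (IntermediateField.adjoin (IntermediateField.adjoin ℝ {PK}) {QK}) hK).natDegree
  rw [natDegree_minpoly_h]
  decide
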